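/- There exists an absolute constant C such that every connected weighted graph G on n ≥ 2 vertices with positive edge weights has a spanner H with at most C·n edges and stretch at most C·(log n)·4^{log* n}, i.e., H is a (C·(log n)·4^{log* n})-spanner of G. -/

import Mathlib

open SimpleGraph

/-- Weighted shortest-path distance in a graph `G` with edge weights `w`
(`⊤` if `u` and `v` are not connected). For `w = fun _ => 1` this is the hop distance. -/
noncomputable def wdist {V : Type*} (G : SimpleGraph V) (w : Sym2 V → NNReal) (u v : V) :
    ENNReal :=
  ⨅ p : G.Walk u v, ((p.edges.map w).sum : ENNReal)

/-- `H` is an `α`-spanner of the weighted graph `(G, w)`: `H` is a subgraph of `G` and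
all pairwise distances are stretched by a factor of at most `α`. -/
def IsSpanner {V : Type*} (G H : SimpleGraph V) (w : Sym2 V → NNReal) (α : ℝ) : Prop :=
  H ≤ G ∧ ∀ u v : V, wdist H w u v ≤ ENNReal.ofReal α * wdist G w u v


/-- The iterated (base-2) logarithm: the number of times `logb 2` must be applied to `x`
before the result becomes at most `1`. -/
noncomputable def logStar (x : ℝ) : ℕ :=
  sInf {k : ℕ | (Real.logb 2)^[k] x ≤ 1}

/-- In `H`, every walk joining the ends of an edge without using that edge has more than `t`
edges; equivalently, `H` has no cycle of length at most `t + 1`. -/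
def NoShortDetour {V : Type*} (H : SimpleGraph V) (t : ℕ) : Prop :=
  ∀ ⦃u v : V⦄, H.Adj u v → ∀ p : H.Walk u v, s(u, v) ∉ p.edges → t < p.length

namespace NoShortDetour

variable {V : Type*} {H : SimpleGraph V} {t : ℕ}

theorem induce (h : NoShortDetour H t) (S : Set V) : NoShortDetour (H.induce S) t := by
  intro u v huv p hp
  let f : H.induce S →g H := (SimpleGraph.Embedding.induce S).toHom
  rw [← p.length_map f]
  refine h (u := f u) (v := f v) huv (p.map f) fun hmem ↦ hp ?_
  rw [SimpleGraph.Walk.edges_map, List.mem_map] at hmem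
  obtain ⟨e, he, heq⟩ := hmem
  have hinj : Function.Injective (Sym2.map f) := Sym2.map.injective Subtype.val_injective
  rwa [← hinj (heq.trans (Sym2.map_mk f u v).symm)]

theorem eq_of_adj_of_dist_le (h : NoShortDetour H t) {r x x' y : V}
    (hx : H.Reachable r x) (hx' : H.Reachable r x') (hyx : H.Adj y x) (hyx' : H.Adj y x')
    (hd : H.dist r x ≤ H.dist r y) (hd' : H.dist r x' ≤ H.dist r y)
    (hlen : H.dist r x + H.dist r x' + 1 ≤ t) : x = x' := by
  classical
  have notMem_support : ∀ {z : V} (p : H.Walk r z), p.length = H.dist r z →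
      H.Adj y z → H.dist r z ≤ H.dist r y → y ∉ p.support := by
    intro z p hp hyz hdz hy
    have h1 := p.length_takeUntil_lt_length hy hyz.ne
    have h2 := SimpleGraph.dist_le (p.takeUntil y hy)
    omega
  obtain ⟨p, hp⟩ := hx.exists_walk_length_eq_dist
  obtain ⟨p', hp'⟩ := hx'.exists_walk_length_eq_dist
  by_contra hne
  have := h hyx.symm (p.reverse.append (p'.concat hyx'.symm)) ?_
  · simp at this
    omega
  · simp only [SimpleGraph.Walk.edges_append, SimpleGraph.Walk.edges_reverse,
      SimpleGraph.Walk.edges_concat, List.mem_append, List.mem_reverse, not_or]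
    refine ⟨fun hm ↦ notMem_support p hp hyx hd (p.snd_mem_support_of_mem_edges hm), fun hm ↦ ?_⟩
    rw [List.concat_eq_append, List.mem_append] at hm
    rcases hm with hm | hm
    · exact notMem_support p' hp' hyx' hd' (p'.snd_mem_support_of_mem_edges hm)
    · rw [List.mem_singleton, Sym2.congr_left] at hm
      exact hne hm

/-- Moore bound for graphs of minimum degree at least three. -/
theorem two_pow_le_card [Fintype V] [Nonempty V] [DecidableRel H.Adj] {k : ℕ}
    (h : NoShortDetour H (2 * k - 1)) (hdeg : ∀ v, 3 ≤ H.degree v) : 2 ^ k ≤ Fintype.card V := by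
  classical
  obtain ⟨r⟩ := ‹Nonempty V›
  let S : ℕ → Finset V := fun i ↦ {x | H.Reachable r x ∧ H.dist r x = i}
  have hS : ∀ i ≤ k, 2 ^ i ≤ (S i).card := by
    intro i hi
    induction i with
    | zero => simpa using ⟨r, by simp [S]⟩
    | succ i ih =>
      have hcount := Finset.card_mul_le_card_mul H.Adj (s := S i) (t := S (i + 1)) (m := 2) (n := 1)
        ?_ ?_
      · have := ih (by omega)
        rw [pow_succ]
        omega
      · intro y hy
        simp only [S, Finset.mem_filter_univ] at hy
        obtain ⟨hry, hdy⟩ := hy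
        let N : Finset V := {x ∈ H.neighborFinset y | H.dist r x ≤ i}
        have hN : N.card ≤ 1 := by
          rw [Finset.card_le_one]
          intro x hx x' hx'
          simp only [N, Finset.mem_filter, SimpleGraph.mem_neighborFinset] at hx hx'
          exact h.eq_of_adj_of_dist_le (hry.trans hx.1.reachable) (hry.trans hx'.1.reachable)
            hx.1 hx'.1 (by omega) (by omega) (by omega)
        have hsub : H.neighborFinset y ⊆ (S (i + 1)).bipartiteAbove H.Adj y ∪ N := by
          intro x hx
          rw [SimpleGraph.mem_neighborFinset] at hx
          have hle : H.dist r x ≤ i + 1 := by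
            obtain ⟨p, hp⟩ := hry.exists_walk_length_eq_dist
            have := SimpleGraph.dist_le (p.concat hx)
            rw [SimpleGraph.Walk.length_concat] at this
            omega
          have hrx := hry.trans hx.reachable
          simp only [Finset.mem_union, Finset.mem_bipartiteAbove, S, N, Finset.mem_filter,
            Finset.mem_univ, true_and, SimpleGraph.mem_neighborFinset]
          by_cases hxi : H.dist r x ≤ i
          · exact Or.inr ⟨hx, hxi⟩
          · exact Or.inl ⟨⟨hrx, by omega⟩, hx⟩
        have h1 := (Finset.card_le_card hsub).trans (Finset.card_union_le _ _)
        rw [SimpleGraph.card_neighborFinset_eq_degree] at h1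
        have h2 := hdeg y
        omega
      · intro z hz
        simp only [S, Finset.mem_filter_univ] at hz
        rw [Finset.card_le_one]
        intro x hx x' hx'
        simp only [S, Finset.mem_bipartiteBelow, Finset.mem_filter_univ] at hx hx'
        exact h.eq_of_adj_of_dist_le hx.1.1 hx'.1.1 hx.2.symm hx'.2.symm (by omega) (by omega)
          (by omega)
  exact (hS k le_rfl).trans (Finset.card_le_univ _)

theorem ncard_edgeSet_le [Finite V] {k : ℕ} (h : NoShortDetour H (2 * k - 1))
    (hk : Nat.card V < 2 ^ k) : H.edgeSet.ncard ≤ 2 * Nat.card V := by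
  classical
  induction hn : Nat.card V generalizing V with
  | zero =>
    have := Finite.card_eq_zero_iff.mp hn
    simp [Set.eq_empty_of_isEmpty]
  | succ n ih =>
    have := Fintype.ofFinite V
    have : Nonempty V := Finite.card_pos_iff.mp (by omega)
    obtain ⟨v, hv⟩ : ∃ v, H.degree v < 3 := by
      by_contra! hdeg
      have := h.two_pow_le_card hdeg
      rw [Nat.card_eq_fintype_card] at hk
      omega
    have hcard : Nat.card ({v}ᶜ : Set V) = n := by
      rw [Nat.card_coe_set_eq, Set.ncard_compl, Set.ncard_singleton, hn, Nat.add_sub_cancel]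
    have hle := ih (h.induce {v}ᶜ) (by omega) hcard
    have hedge := H.card_edgeFinset_induce_compl_singleton v
    have hdelete := H.card_edgeFinset_deleteIncidenceSet v
    rw [← SimpleGraph.coe_edgeFinset, Set.ncard_coe_finset] at hle ⊢
    omega

end NoShortDetour

/-- Crossings of an added edge by a walk can be reduced to at most one. -/
theorem exists_walk_of_walk_sup_edge {V : Type*} {H : SimpleGraph V} {u v : V} {x y : V}
    (p : (H ⊔ SimpleGraph.edge u v).Walk x y) :
    (∃ q : H.Walk x y, q.length ≤ p.length ∧ q.edges ⊆ p.edges) ∨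
      ∃ a b, s(a, b) = s(u, v) ∧ ∃ (q₁ : H.Walk x a) (q₂ : H.Walk b y),
        q₁.length + q₂.length + 1 ≤ p.length ∧ q₂.edges ⊆ p.edges ∧ s(u, v) ∈ p.edges := by
  induction p with
  | nil => exact Or.inl ⟨.nil, by simp⟩
  | @cons x x' y hadj p ih =>
    have htail : p.edges ⊆ (SimpleGraph.Walk.cons hadj p).edges := by
      rw [SimpleGraph.Walk.edges_cons]
      exact List.subset_cons_self _ _
    have hhead : s(x, x') = s(u, v) → s(u, v) ∈ (SimpleGraph.Walk.cons hadj p).edges := by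
      intro heq
      simp [← heq]
    by_cases hH : H.Adj x x'
    · rcases ih with ⟨q, hq, hqe⟩ | ⟨a, b, hab, q₁, q₂, hq, hqe, he⟩
      · refine Or.inl ⟨.cons hH q, by simpa using hq, ?_⟩
        simpa using List.cons_subset_cons _ hqe
      · refine Or.inr ⟨a, b, hab, .cons hH q₁, q₂, ?_, List.Subset.trans hqe htail, htail he⟩
        simp only [SimpleGraph.Walk.length_cons]
        omega
    · have hxx' : s(x, x') = s(u, v) := by
        rw [SimpleGraph.sup_adj, SimpleGraph.edge_adj] at hadj
        simpa using (hadj.resolve_left hH).1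
      rcases ih with ⟨q, hq, hqe⟩ | ⟨a, b, hab, q₁, q₂, hq, hqe, he⟩
      · exact Or.inr ⟨x, x', hxx', .nil, q, by simpa using hq, List.Subset.trans hqe htail, hhead hxx'⟩
      · have hax := hab.trans hxx'.symm
        rw [Sym2.eq_iff] at hax
        rcases hax with ⟨rfl, rfl⟩ | ⟨rfl, rfl⟩
        · refine Or.inr ⟨_, _, hxx', .nil, q₂, ?_, List.Subset.trans hqe htail, hhead hxx'⟩
          simp only [SimpleGraph.Walk.length_cons, SimpleGraph.Walk.length_nil]
          omega
        · refine Or.inl ⟨q₂, ?_, List.Subset.trans hqe htail⟩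
          simp only [SimpleGraph.Walk.length_cons]
          omega

theorem NoShortDetour.sup_edge {V : Type*} {H : SimpleGraph V} {t : ℕ} {u v : V}
    (h : NoShortDetour H t) (huv : ∀ p : H.Walk u v, t < p.length) :
    NoShortDetour (H ⊔ SimpleGraph.edge u v) t := by
  have hlong : ∀ {a b : V}, s(a, b) = s(u, v) → ∀ p : H.Walk a b, t < p.length := by
    intro a b hab p
    rw [Sym2.eq_iff] at hab
    rcases hab with ⟨rfl, rfl⟩ | ⟨rfl, rfl⟩
    · exact huv p
    · simpa using huv p.reverse
  intro x y hxy p hp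
  rcases exists_walk_of_walk_sup_edge p with ⟨q, hq, hqe⟩ | ⟨a, b, hab, q₁, q₂, hq, hqe, he⟩
  · refine lt_of_lt_of_le ?_ hq
    by_cases hH : H.Adj x y
    · exact h hH q fun hm ↦ hp (hqe hm)
    · rw [SimpleGraph.sup_adj, SimpleGraph.edge_adj] at hxy
      exact hlong (by simpa using (hxy.resolve_left hH).1) q
  · by_cases hH : H.Adj x y
    · have := hlong hab (q₁.reverse.append (.cons hH q₂.reverse))
      simp at this
      omega
    · rw [SimpleGraph.sup_adj, SimpleGraph.edge_adj] at hxy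
      have hxe : s(x, y) = s(u, v) := by simpa using (hxy.resolve_left hH).1
      exact (hp (hxe ▸ he)).elim

/-- The greedy spanner. -/
theorem exists_noShortDetour_le {V : Type*} [Finite V] (w : Sym2 V → NNReal) {t : ℕ} (ht : 1 ≤ t)
    (G : SimpleGraph V) :
    ∃ H ≤ G, NoShortDetour H t ∧
      ∀ ⦃u v⦄, G.Adj u v → ∃ p : H.Walk u v, (p.edges.map w).sum ≤ t * w s(u, v) := by
  induction hm : G.edgeSet.ncard generalizing G with
  | zero =>
    have hG : ∀ u v, ¬ G.Adj u v := by
      intro u v huv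
      rw [Set.ncard_eq_zero] at hm
      exact (hm ▸ (SimpleGraph.mem_edgeSet G).mpr huv : s(u, v) ∈ (∅ : Set (Sym2 V)))
    exact ⟨G, le_rfl, fun u v huv ↦ (hG u v huv).elim, fun u v huv ↦ (hG u v huv).elim⟩
  | succ m ih =>
    obtain ⟨e, he, hmax⟩ := G.edgeSet.exists_max_image w G.edgeSet.toFinite
      (Set.nonempty_of_ncard_ne_zero (by omega))
    induction e with | _ u v
    have hdel : (G.deleteEdges {s(u, v)}).edgeSet.ncard = m := by
      rw [SimpleGraph.edgeSet_deleteEdges, Set.ncard_sdiff_singleton_of_mem he, hm,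
        Nat.add_sub_cancel]
    obtain ⟨H, hHG, hH, hspan⟩ := ih _ hdel
    have hHG' : H ≤ G := hHG.trans (G.deleteEdges_le _)
    by_cases hex : ∃ p : H.Walk u v, p.length ≤ t
    · obtain ⟨p, hp⟩ := hex
      have hpw : (p.edges.map w).sum ≤ t * w s(u, v) := by
        calc (p.edges.map w).sum ≤ (p.edges.map w).length • w s(u, v) := by
              refine List.sum_le_card_nsmul _ _ fun x hx ↦ ?_
              obtain ⟨f, hf, rfl⟩ := List.mem_map.mp hx
              exact hmax f (SimpleGraph.edgeSet_mono hHG' (p.edges_subset_edgeSet hf))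
          _ ≤ t * w s(u, v) := by
              rw [List.length_map, SimpleGraph.Walk.length_edges, nsmul_eq_mul]
              gcongr
      refine ⟨H, hHG', hH, fun x y hxy ↦ ?_⟩
      by_cases hxe : s(x, y) = s(u, v)
      · rw [hxe]
        rw [Sym2.eq_iff] at hxe
        rcases hxe with ⟨rfl, rfl⟩ | ⟨rfl, rfl⟩
        · exact ⟨p, hpw⟩
        · exact ⟨p.reverse, by simpa [List.sum_reverse] using hpw⟩
      · exact hspan (by simp [SimpleGraph.deleteEdges_adj, hxy, hxe])
    · push Not at hex
      have huv : G.Adj u v := he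
      refine ⟨H ⊔ SimpleGraph.edge u v, sup_le hHG' ?_, hH.sup_edge hex, fun x y hxy ↦ ?_⟩
      · rw [SimpleGraph.edge_le_iff]
        exact Or.inr huv
      · by_cases hxe : s(x, y) = s(u, v)
        · have hadj : (H ⊔ SimpleGraph.edge u v).Adj x y := by
            refine Or.inr ((SimpleGraph.edge_adj ..).mpr ⟨?_, hxy.ne⟩)
            simpa using hxe
          refine ⟨hadj.toWalk, ?_⟩
          simpa using le_mul_of_one_le_left (zero_le) (by exact_mod_cast ht : (1 : NNReal) ≤ t)
        · obtain ⟨p, hp⟩ := hspan (by simp [SimpleGraph.deleteEdges_adj, hxy, hxe] :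
            (G.deleteEdges {s(u, v)}).Adj x y)
          exact ⟨p.mapLe le_sup_left, by simpa using hp⟩

theorem isSpanner_of_forall_adj {V : Type*} {G H : SimpleGraph V} {w : Sym2 V → NNReal} {t : ℕ}
    {α : ℝ} (hHG : H ≤ G) (ht : 0 < t) (htα : (t : ℝ) ≤ α)
    (h : ∀ ⦃u v⦄, G.Adj u v → ∃ p : H.Walk u v, (p.edges.map w).sum ≤ t * w s(u, v)) :
    IsSpanner G H w α := by
  refine ⟨hHG, fun u v ↦ ?_⟩
  have hwalk : ∀ {u v : V} (p : G.Walk u v),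
      ∃ q : H.Walk u v, (q.edges.map w).sum ≤ t * (p.edges.map w).sum := by
    intro u v p
    induction p with
    | nil => exact ⟨.nil, by simp⟩
    | cons hadj p ih =>
      obtain ⟨q₁, hq₁⟩ := h hadj
      obtain ⟨q₂, hq₂⟩ := ih
      refine ⟨q₁.append q₂, ?_⟩
      simpa [mul_add] using add_le_add hq₁ hq₂
  have hα : (t : ENNReal) ≤ ENNReal.ofReal α := by
    rw [← ENNReal.ofReal_natCast]
    exact ENNReal.ofReal_le_ofReal htα
  refine le_trans ?_ (mul_le_mul_left hα _)
  unfold wdist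
  rw [ENNReal.mul_iInf_of_ne (by exact_mod_cast ht.ne') (ENNReal.natCast_ne_top t)]
  refine le_iInf fun p ↦ ?_
  obtain ⟨q, hq⟩ := hwalk p
  exact (iInf_le _ q).trans (by exact_mod_cast hq)

/-- every connected weighted graph on `n ≥ 2` vertices with positive edge
weights has a spanner with `O(n)` edges and stretch `O(log n · 4^(log* n))`. -/
theorem exists_linear_size_spanner_weighted :
    ∃ C : ℝ, 0 < C ∧
      ∀ (n : ℕ), 2 ≤ n →
        ∀ (G : SimpleGraph (Fin n)) (w : Sym2 (Fin n) → NNReal),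
          G.Connected → (∀ e ∈ G.edgeSet, 0 < w e) →
          ∃ H : SimpleGraph (Fin n),
            IsSpanner G H w (C * Real.logb 2 n * (4 : ℝ) ^ logStar (n : ℝ)) ∧
            (H.edgeSet.ncard : ℝ) ≤ C * n := by
  refine ⟨3, by norm_num, fun n hn G w _ _ ↦ ?_⟩
  set k := Nat.log 2 n + 1 with hk
  obtain ⟨H, hHG, hH, hspan⟩ := exists_noShortDetour_le w (t := 2 * k - 1) (by omega) G
  refine ⟨H, isSpanner_of_forall_adj hHG (by omega) ?_ hspan, ?_⟩
  · have hlog : (Nat.log 2 n : ℝ) ≤ Real.logb 2 n := by exact_mod_cast Real.natLog_le_logb n 2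
    have hone : (1 : ℝ) ≤ Real.logb 2 n := by
      rw [Real.le_logb_iff_rpow_le (by norm_num) (by positivity)]
      simpa using (by exact_mod_cast hn : (2 : ℝ) ≤ n)
    have hcast : ((2 * k - 1 : ℕ) : ℝ) = 2 * Nat.log 2 n + 1 := by
      rw [show 2 * k - 1 = 2 * Nat.log 2 n + 1 by omega]
      push_cast
      rfl
    rw [hcast]
    calc (2 * Nat.log 2 n + 1 : ℝ) ≤ 3 * Real.logb 2 n := by linarith
      _ ≤ 3 * Real.logb 2 n * 4 ^ logStar (n : ℝ) :=
        le_mul_of_one_le_right (by positivity) (one_le_pow₀ (by norm_num))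
  · have hle := hH.ncard_edgeSet_le (by simpa using Nat.lt_pow_succ_log_self one_lt_two n)
    rw [Nat.card_fin] at hle
    calc (H.edgeSet.ncard : ℝ) ≤ 2 * n := by exact_mod_cast hle
      _ ≤ 3 * n := by gcongr; norm_num
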